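/- arXiv:2303.08902 — 4 statements merged into one kernel-verified Lean document; each statement's English description precedes it below -/
import Mathlib

section
/- Exponential convergence of the exact power method. Assume Λ > (E0 + Emax)/2 and let ρ = max(|Λ − E1|, |Emax − Λ|) / (Λ − E0), so that 0 ≤ ρ < 1. Let Ψ⁽⁰⁾ ∈ V satisfy ⟨Υ0, Ψ⁽⁰⁾⟩ ≠ 0 and define Ψ⁽ⁿ⁾ = (Λ − H)ⁿ Ψ⁽⁰⁾. Then Ψ⁽ⁿ⁾ ≠ 0 for all n and 1 − F(Υ0, Ψ⁽ⁿ⁾) ≤ ρ²ⁿ · (1 − F(Υ0, Ψ⁽⁰⁾)) / F(Υ0, Ψ⁽⁰⁾), so the infidelity with the ground state tends to 0 geometrically. -/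
open scoped ComplexInnerProductSpace

/-- Fidelity between two states `φ` and `ψ`:
`F(φ, ψ) = |⟨φ, ψ⟩|² / (‖φ‖² ‖ψ‖²)`. -/
noncomputable def fid {V : Type*} [NormedAddCommGroup V] [InnerProductSpace ℂ V]
    (φ ψ : V) : ℝ := ‖⟪φ, ψ⟫‖ ^ 2 / (‖φ‖ ^ 2 * ‖ψ‖ ^ 2)

/-- Tangent of the Fubini–Study angle: `tan θ(φ, ψ) = √((1 − F(φ, ψ)) / F(φ, ψ))`. -/
noncomputable def tanθ {V : Type*} [NormedAddCommGroup V] [InnerProductSpace ℂ V]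
    (φ ψ : V) : ℝ := Real.sqrt ((1 - fid φ ψ) / fid φ ψ)

section PowerMethod

variable {V : Type*} [NormedAddCommGroup V] [InnerProductSpace ℂ V]

/-- A symmetric operator whose quadratic form is bounded by `M` on an invariant subspace
is bounded by `M` there. -/
theorem LinearMap.IsSymmetric.norm_apply_le_of_abs_re_inner_le {A : V →ₗ[ℂ] V}
    (hA : A.IsSymmetric) {W : Submodule ℂ V} (hW : ∀ x ∈ W, A x ∈ W) {M : ℝ} (hM : 0 ≤ M)
    (hbound : ∀ x ∈ W, |(⟪x, A x⟫).re| ≤ M * ‖x‖ ^ 2) {x : V} (hx : x ∈ W) :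
    ‖A x‖ ≤ M * ‖x‖ := by
  have key (t : ℝ) : 4 * t * ‖A x‖ ^ 2 ≤ 2 * M * (t ^ 2 * ‖A x‖ ^ 2 + ‖x‖ ^ 2) := by
    have hty : (t : ℂ) • A x ∈ W := W.smul_mem _ (hW x hx)
    have h₁ := (le_abs_self _).trans (hbound _ (W.add_mem hx hty))
    have h₂ := (neg_le_abs _).trans (hbound _ (W.sub_mem hx hty))
    have hpar := parallelogram_law_with_norm ℂ x ((t : ℂ) • A x)
    have hnorm : ‖(t : ℂ) • A x‖ ^ 2 = t ^ 2 * ‖A x‖ ^ 2 := by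
      rw [norm_smul, mul_pow, Complex.norm_real, Real.norm_eq_abs, sq_abs]
    have hpol : (⟪x + (t : ℂ) • A x, A (x + (t : ℂ) • A x)⟫).re
        - (⟪x - (t : ℂ) • A x, A (x - (t : ℂ) • A x)⟫).re = 4 * t * ‖A x‖ ^ 2 := by
      have hself : (⟪A x, A x⟫).re = ‖A x‖ ^ 2 := inner_self_eq_norm_sq (𝕜 := ℂ) (A x)
      simp only [map_add, map_sub, map_smul, inner_add_left, inner_add_right, inner_sub_left,
        inner_sub_right, inner_smul_left, inner_smul_right, Complex.conj_ofReal,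
        ← hA x (A x), Complex.add_re, Complex.sub_re, Complex.re_ofReal_mul, hself]
      ring
    nlinarith
  rcases hM.eq_or_lt with rfl | hM
  · have := key 1
    have : ‖A x‖ ^ 2 = 0 := le_antisymm (by linarith) (sq_nonneg _)
    simp [pow_eq_zero_iff two_ne_zero |>.mp this]
  · refine abs_le_of_sq_le_sq' ?_ (by positivity) |>.2
    have h := mul_le_mul_of_nonneg_left (key M⁻¹) hM.le
    field_simp at h
    nlinarith

/-- Pythagoras for the component of `ψ` orthogonal to the unit vector `u`. -/
theorem norm_sq_eq_norm_inner_sq_add {u : V} (hu : ‖u‖ = 1) (ψ : V) :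
    ‖ψ‖ ^ 2 = ‖⟪u, ψ⟫‖ ^ 2 + ‖ψ - ⟪u, ψ⟫ • u‖ ^ 2 := by
  have horth : ⟪⟪u, ψ⟫ • u, ψ - ⟪u, ψ⟫ • u⟫ = 0 := by
    rw [inner_smul_left, inner_sub_right, inner_smul_right, inner_self_eq_norm_sq_to_K, hu]
    simp
  have h := norm_add_sq_eq_norm_sq_add_norm_sq_of_inner_eq_zero _ _ horth
  rw [add_sub_cancel, norm_smul, hu, mul_one] at h
  simpa only [sq] using h

theorem one_sub_fid {u ψ : V} (hu : ‖u‖ = 1) (hψ : ψ ≠ 0) :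
    1 - fid u ψ = ‖ψ - ⟪u, ψ⟫ • u‖ ^ 2 / ‖ψ‖ ^ 2 := by
  have hψ' : ‖ψ‖ ^ 2 ≠ 0 := by simpa using hψ
  rw [fid, hu, one_pow, one_mul, eq_div_iff hψ', sub_mul, div_mul_cancel₀ _ hψ']
  linarith [norm_sq_eq_norm_inner_sq_add hu ψ]

theorem one_sub_fid_le {u ψ : V} (hu : ‖u‖ = 1) (hψ : ⟪u, ψ⟫ ≠ 0) :
    1 - fid u ψ ≤ ‖ψ - ⟪u, ψ⟫ • u‖ ^ 2 / ‖⟪u, ψ⟫‖ ^ 2 := by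
  rw [one_sub_fid hu (by rintro rfl; simp at hψ)]
  have : 0 < ‖⟪u, ψ⟫‖ := norm_pos_iff.mpr hψ
  gcongr
  simpa [hu] using norm_inner_le_norm (𝕜 := ℂ) u ψ

theorem one_sub_fid_div_fid {u ψ : V} (hu : ‖u‖ = 1) (hψ : ψ ≠ 0) :
    (1 - fid u ψ) / fid u ψ = ‖ψ - ⟪u, ψ⟫ • u‖ ^ 2 / ‖⟪u, ψ⟫‖ ^ 2 := by
  have hψ' : ‖ψ‖ ^ 2 ≠ 0 := by simpa using hψ
  rw [one_sub_fid hu hψ, fid, hu, one_pow, one_mul, div_div_div_cancel_right₀ hψ']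

end PowerMethod

/-- **Exponential convergence of the exact power method.** -/
theorem power_method_exponential_convergence
    {V : Type*} [NormedAddCommGroup V] [InnerProductSpace ℂ V] [FiniteDimensional ℂ V]
    (H : V →ₗ[ℂ] V) (hH : H.IsSymmetric)
    (Υ0 : V) (hΥ0 : ‖Υ0‖ = 1)
    (E0 E1 Emax δ Λ ρ : ℝ)
    (hgs : H Υ0 = (E0 : ℂ) • Υ0)
    (hE01 : E0 ≤ E1) (hE1max : E1 ≤ Emax)
    (hspec : ∀ ψ : V, ⟪Υ0, ψ⟫ = 0 →
      E1 * ‖ψ‖ ^ 2 ≤ (⟪ψ, H ψ⟫).re ∧ (⟪ψ, H ψ⟫).re ≤ Emax * ‖ψ‖ ^ 2)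
    (hδ : δ = E1 - E0) (hδpos : 0 < δ)
    (hΛ : (E0 + Emax) / 2 < Λ)
    (hρ : ρ = max |Λ - E1| |Emax - Λ| / (Λ - E0))
    (Ψ : ℕ → V)
    (hrec : ∀ n, Ψ (n + 1) = (Λ : ℂ) • Ψ n - H (Ψ n))
    (hover : ⟪Υ0, Ψ 0⟫ ≠ 0) :
    (0 ≤ ρ ∧ ρ < 1) ∧ (∀ n, Ψ n ≠ 0) ∧
    ∀ n, 1 - fid Υ0 (Ψ n) ≤ ρ ^ (2 * n) * ((1 - fid Υ0 (Ψ 0)) / fid Υ0 (Ψ 0)) := by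
  have hgap : 0 < Λ - E0 := by linarith
  set M := max |Λ - E1| |Emax - Λ| with hM
  have hM0 : 0 ≤ M := (abs_nonneg _).trans (le_max_left _ _)
  have hM1 : M < Λ - E0 := by
    rw [hM, max_lt_iff, abs_lt, abs_lt]
    refine ⟨⟨?_, ?_⟩, ?_, ?_⟩ <;> linarith
  let A : V →ₗ[ℂ] V := (Λ : ℂ) • LinearMap.id - H
  have hAapp (x : V) : A x = (Λ : ℂ) • x - H x := rfl
  have hA : A.IsSymmetric := fun x y => by
    rw [hAapp, hAapp, inner_sub_left, inner_sub_right, inner_smul_left, inner_smul_right, hH x y,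
      Complex.conj_ofReal]
  have hAgs : A Υ0 = ((Λ - E0 : ℝ) : ℂ) • Υ0 := by
    rw [hAapp, hgs, ← sub_smul, Complex.ofReal_sub]
  have hinner (x : V) : ⟪Υ0, A x⟫ = ((Λ - E0 : ℝ) : ℂ) * ⟪Υ0, x⟫ := by
    rw [← hA, hAgs, inner_smul_left, Complex.conj_ofReal]
  have hstep (n : ℕ) : Ψ (n + 1) = A (Ψ n) := hrec n
  have hcontract (x : V) (hx : ⟪Υ0, x⟫ = 0) : ‖A x‖ ≤ M * ‖x‖ := by
    refine hA.norm_apply_le_of_abs_re_inner_le (W := (ℂ ∙ Υ0)ᗮ) ?_ hM0 ?_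
      (Submodule.mem_orthogonal_singleton_iff_inner_right.mpr hx)
    · intro y hy
      rw [Submodule.mem_orthogonal_singleton_iff_inner_right] at hy ⊢
      rw [hinner, hy, mul_zero]
    · intro y hy
      obtain ⟨hlow, hup⟩ := hspec y (Submodule.mem_orthogonal_singleton_iff_inner_right.mp hy)
      have hself : (⟪y, y⟫).re = ‖y‖ ^ 2 := inner_self_eq_norm_sq (𝕜 := ℂ) y
      have h₁ : Λ - E1 ≤ M := (le_abs_self _).trans (le_max_left _ _)
      have h₂ : Emax - Λ ≤ M := (le_abs_self _).trans (le_max_right _ _)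
      rw [hAapp, inner_sub_right, inner_smul_right, Complex.sub_re, Complex.re_ofReal_mul,
        hself, abs_le]
      constructor <;> nlinarith [sq_nonneg ‖y‖]
  have hoverlap (n : ℕ) : ⟪Υ0, Ψ n⟫ = ((Λ - E0 : ℝ) : ℂ) ^ n * ⟪Υ0, Ψ 0⟫ := by
    induction n with
    | zero => simp
    | succ n ih => rw [hstep, hinner, ih]; ring
  have hoverlap_ne (n : ℕ) : ⟪Υ0, Ψ n⟫ ≠ 0 := by
    rw [hoverlap]
    exact mul_ne_zero (pow_ne_zero _ (Complex.ofReal_ne_zero.mpr hgap.ne')) hover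
  have hne (n : ℕ) : Ψ n ≠ 0 := fun h => hoverlap_ne n (by simp [h])
  have hperp (n : ℕ) :
      ‖Ψ n - ⟪Υ0, Ψ n⟫ • Υ0‖ ≤ M ^ n * ‖Ψ 0 - ⟪Υ0, Ψ 0⟫ • Υ0‖ := by
    induction n with
    | zero => simp
    | succ n ih =>
      have hmap : Ψ (n + 1) - ⟪Υ0, Ψ (n + 1)⟫ • Υ0 = A (Ψ n - ⟪Υ0, Ψ n⟫ • Υ0) := by
        rw [hstep, hinner, map_sub, map_smul, hAgs, smul_smul, mul_comm]
      rw [hmap, pow_succ', mul_assoc]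
      refine (hcontract _ ?_).trans (mul_le_mul_of_nonneg_left ih hM0)
      rw [inner_sub_right, inner_smul_right, inner_self_eq_norm_sq_to_K, hΥ0]
      simp
  refine ⟨⟨?_, ?_⟩, hne, fun n => ?_⟩
  · rw [hρ]; positivity
  · rwa [hρ, div_lt_one hgap]
  · calc 1 - fid Υ0 (Ψ n)
        ≤ ‖Ψ n - ⟪Υ0, Ψ n⟫ • Υ0‖ ^ 2 / ‖⟪Υ0, Ψ n⟫‖ ^ 2 := one_sub_fid_le hΥ0 (hoverlap_ne n)
      _ ≤ (M ^ n * ‖Ψ 0 - ⟪Υ0, Ψ 0⟫ • Υ0‖) ^ 2 / ‖⟪Υ0, Ψ n⟫‖ ^ 2 := by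
        gcongr
        exact hperp n
      _ = ρ ^ (2 * n) * ((1 - fid Υ0 (Ψ 0)) / fid Υ0 (Ψ 0)) := by
        rw [one_sub_fid_div_fid hΥ0 (hne 0), hoverlap n, hρ, norm_mul, norm_pow,
          Complex.norm_of_nonneg hgap.le, mul_pow, mul_pow, ← pow_mul, ← pow_mul,
          mul_comm n 2, div_pow, div_mul_div_comm]
end

section
/- Noise norm bounded by the step infidelity. Let V be a finite-dimensional complex inner product space and H : V → V a self-adjoint linear operator with E0 ‖ψ‖² ≤ ⟨ψ, H ψ⟩ ≤ Emax ‖ψ‖² for every ψ ∈ V, and let Λ ≥ (E0 + Emax)/2. Let Ψ ∈ V be nonzero with φ := (Λ − H) Ψ ≠ 0, let Δ ∈ V satisfy ⟨Δ, φ⟩ = 0, let γ be a nonzero complex scalar, and set Ψ' = γ (φ + Δ). If I := 1 − F(Ψ', φ) satisfies I < 1, then ‖Δ‖ / ‖Ψ‖ ≤ (Λ − E0) · √(I / (1 − I)). -/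
open scoped ComplexInnerProductSpace

/-- A symmetric operator whose quadratic form is bounded by `c ‖x‖²` has norm at most `c`. -/
theorem LinearMap.IsSymmetric.norm_apply_le_of_abs_re_inner_le_s2
    {V : Type*} [NormedAddCommGroup V] [InnerProductSpace ℂ V] {A : V →ₗ[ℂ] V}
    (hA : A.IsSymmetric) {c : ℝ} (h : ∀ x : V, |(⟪x, A x⟫).re| ≤ c * ‖x‖ ^ 2) (x : V) :
    ‖A x‖ ≤ c * ‖x‖ := by
  have polar (u v : V) : 2 * (⟪v, A u⟫).re ≤ c * (‖u‖ ^ 2 + ‖v‖ ^ 2) := by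
    have hp := (abs_le.1 (h (u + v))).2
    have hm := (abs_le.1 (h (u - v))).1
    have hs : (⟪u, A v⟫).re = (⟪v, A u⟫).re := by
      rw [← hA u v]
      exact inner_re_symm (𝕜 := ℂ) (A u) v
    have hpar := parallelogram_law_with_norm ℂ u v
    simp only [map_add, map_sub, inner_add_left, inner_add_right, inner_sub_left,
      inner_sub_right, Complex.add_re, Complex.sub_re] at hp hm
    have hc : c * ‖u + v‖ ^ 2 + c * ‖u - v‖ ^ 2 = 2 * (c * (‖u‖ ^ 2 + ‖v‖ ^ 2)) := by
      linear_combination c * hpar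
    linarith
  rcases eq_or_ne x 0 with rfl | hx
  · simp
  rcases eq_or_ne (A x) 0 with hAx | hAx
  · have hc : 0 ≤ c * ‖x‖ ^ 2 := (abs_nonneg _).trans (h x)
    have hx' : 0 < ‖x‖ := norm_pos_iff.2 hx
    rw [hAx, norm_zero]
    exact mul_nonneg (nonneg_of_mul_nonneg_left hc (by positivity)) hx'.le
  have hx' : 0 < ‖x‖ := norm_pos_iff.2 hx
  have hAx' : 0 < ‖A x‖ := norm_pos_iff.2 hAx
  have key := polar ((‖A x‖ : ℂ) • x) ((‖x‖ : ℂ) • A x)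
  rw [map_smul, inner_smul_left, inner_smul_right, inner_self_eq_norm_sq_to_K, norm_smul,
    norm_smul, Complex.conj_ofReal, Complex.norm_real, Complex.norm_real, norm_norm,
    norm_norm] at key
  have hre : ((‖x‖ : ℂ) * ((‖A x‖ : ℂ) * ((‖A x‖ : ℂ)) ^ 2)).re
      = ‖x‖ * (‖A x‖ * ‖A x‖ ^ 2) := by
    norm_cast
  have key' : 2 * (‖x‖ * (‖A x‖ * ‖A x‖ ^ 2))
      ≤ c * ((‖A x‖ * ‖x‖) ^ 2 + (‖x‖ * ‖A x‖) ^ 2) := hre ▸ key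
  have hpos : 0 < 2 * (‖x‖ * ‖A x‖ ^ 2) := by positivity
  refine le_of_mul_le_mul_left ?_ hpos
  linarith

/-- The fidelity between `φ` and a multiple of an orthogonal perturbation of `φ`. -/
theorem fid_smul_add_of_inner_eq_zero
    {V : Type*} [NormedAddCommGroup V] [InnerProductSpace ℂ V] {φ Δ : V} (hφ : φ ≠ 0)
    (horth : ⟪Δ, φ⟫ = 0) {γ : ℂ} (hγ : γ ≠ 0) :
    fid (γ • (φ + Δ)) φ = ‖φ‖ ^ 2 / (‖φ‖ ^ 2 + ‖Δ‖ ^ 2) := by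
  have hpyth : ‖φ + Δ‖ ^ 2 = ‖φ‖ ^ 2 + ‖Δ‖ ^ 2 := by
    have := norm_add_sq_eq_norm_sq_add_norm_sq_of_inner_eq_zero φ Δ
      (inner_eq_zero_symm.1 horth)
    linarith
  have hφ' : 0 < ‖φ‖ := norm_pos_iff.2 hφ
  have hγ' : 0 < ‖γ‖ := norm_pos_iff.2 hγ
  have hinner : ‖⟪γ • (φ + Δ), φ⟫‖ = ‖γ‖ * ‖φ‖ ^ 2 := by
    rw [inner_smul_left, inner_add_left, horth, add_zero, norm_mul, RCLike.norm_conj,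
      inner_self_eq_norm_sq_to_K, norm_pow]
    simp
  rw [fid, hinner, norm_smul, mul_pow ‖γ‖ ‖φ + Δ‖, hpyth]
  field_simp

/-- **Noise norm bounded by the step infidelity.** -/
theorem noise_norm_le_step_infidelity
    {V : Type*} [NormedAddCommGroup V] [InnerProductSpace ℂ V] [FiniteDimensional ℂ V]
    (H : V →ₗ[ℂ] V) (hH : H.IsSymmetric)
    (E0 Emax Λ : ℝ)
    (hspec : ∀ ψ : V, E0 * ‖ψ‖ ^ 2 ≤ (⟪ψ, H ψ⟫).re ∧ (⟪ψ, H ψ⟫).re ≤ Emax * ‖ψ‖ ^ 2)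
    (hΛ : (E0 + Emax) / 2 ≤ Λ)
    (Ψ : V) (hΨ : Ψ ≠ 0)
    (φ : V) (hφdef : φ = (Λ : ℂ) • Ψ - H Ψ) (hφ : φ ≠ 0)
    (Δ : V) (horth : ⟪Δ, φ⟫ = 0)
    (γ : ℂ) (hγ : γ ≠ 0)
    (Ψ' : V) (hΨ' : Ψ' = γ • (φ + Δ))
    (I : ℝ) (hI : I = 1 - fid Ψ' φ) (hI1 : I < 1) :
    ‖Δ‖ / ‖Ψ‖ ≤ (Λ - E0) * Real.sqrt (I / (1 - I)) := by
  have hΨ0 : 0 < ‖Ψ‖ := norm_pos_iff.2 hΨ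
  have hφ0 : 0 < ‖φ‖ := norm_pos_iff.2 hφ
  have hsym : ((Λ : ℂ) • LinearMap.id - H : V →ₗ[ℂ] V).IsSymmetric :=
    (LinearMap.IsSymmetric.id.smul (Complex.conj_ofReal Λ)).sub hH
  have hbound : ‖φ‖ ≤ (Λ - E0) * ‖Ψ‖ := by
    have := hsym.norm_apply_le_of_abs_re_inner_le_s2 (c := Λ - E0) (fun x => by
      obtain ⟨h1, h2⟩ := hspec x
      have hval : (⟪x, ((Λ : ℂ) • LinearMap.id - H : V →ₗ[ℂ] V) x⟫).re
          = Λ * ‖x‖ ^ 2 - (⟪x, H x⟫).re := by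
        rw [LinearMap.sub_apply, LinearMap.smul_apply, LinearMap.id_apply, inner_sub_right,
          inner_smul_right, inner_self_eq_norm_sq_to_K, Complex.sub_re,
          Complex.re_ofReal_mul]
        norm_cast
      rw [hval, abs_le]
      constructor <;> nlinarith [sq_nonneg ‖x‖]) Ψ
    simpa [hφdef] using this
  have hratio : I / (1 - I) = (‖Δ‖ / ‖φ‖) ^ 2 := by
    rw [hI, hΨ', fid_smul_add_of_inner_eq_zero hφ horth hγ]
    field_simp
    ring
  rw [hratio, Real.sqrt_sq (by positivity), ← mul_div_assoc, div_le_div_iff₀ hΨ0 hφ0]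
  nlinarith [mul_le_mul_of_nonneg_left hbound (norm_nonneg Δ)]
end

section
/- Arithmetic contraction inequality for the tangent recursion. Let σ1 > 0, ξ > 0, ε ≥ 0 and t ≥ 0 be real numbers. Then (σ1 · t + ξ · ε · (1 + t)) / (σ1 + 3ξ) ≤ max(ε, ω · t), where ω = max((σ1 / (σ1 + 4ξ))^{1/4}, ε). -/
lemma div_add_le_rpow_div_add_four_mul {a b : ℝ} (ha : 0 < a) (hb : 0 < b) :
    a / (a + b) ≤ (a / (a + 4 * b)) ^ ((1 : ℝ) / 4) := by
  have h : (a / (a + b)) ^ 4 ≤ a / (a + 4 * b) := by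
    rw [div_pow, div_le_div_iff₀ (by positivity) (by positivity)]
    have : 0 ≤ a * (6 * a ^ 2 * b ^ 2 + 4 * a * b ^ 3 + b ^ 4) := by positivity
    linarith
  calc a / (a + b) = ((a / (a + b)) ^ 4) ^ ((1 : ℝ) / 4) := by
        rw [← Real.rpow_natCast, ← Real.rpow_mul (by positivity)]
        norm_num
    _ ≤ _ := Real.rpow_le_rpow (by positivity) h (by norm_num)

/-- **Arithmetic contraction inequality for the tangent recursion.** -/
theorem tangent_recursion_contraction (σ1 ξ ε t : ℝ)
    (hσ1 : 0 < σ1) (hξ : 0 < ξ) (hε : 0 ≤ ε) (ht : 0 ≤ t) :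
    (σ1 * t + ξ * ε * (1 + t)) / (σ1 + 3 * ξ) ≤
      max ε (max ((σ1 / (σ1 + 4 * ξ)) ^ ((1 : ℝ) / 4)) ε * t) := by
  set ω := max ((σ1 / (σ1 + 4 * ξ)) ^ ((1 : ℝ) / 4)) ε
  have hεω : ε ≤ ω := le_max_right _ _
  have hσω : σ1 ≤ ω * (σ1 + ξ) :=
    (div_le_iff₀ (by positivity)).1
      ((div_add_le_rpow_div_add_four_mul hσ1 hξ).trans (le_max_left _ _))
  set M := max ε (ω * t)
  have hεM : ε ≤ M := le_max_left _ _
  have hωM : ω * t ≤ M := le_max_right _ _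
  rw [div_le_iff₀ (by positivity)]
  calc σ1 * t + ξ * ε * (1 + t) = ξ * ε + σ1 * t + ξ * (ε * t) := by ring
    _ ≤ ξ * M + ω * (σ1 + ξ) * t + ξ * (ω * t) := by gcongr
    _ = ξ * M + (σ1 + 2 * ξ) * (ω * t) := by ring
    _ ≤ ξ * M + (σ1 + 2 * ξ) * M := by gcongr
    _ = M * (σ1 + 3 * ξ) := by ring
end

section
/- Overlap preservation along the noisy power method. Assume Λ ≥ (E1 + Emax)/2 and ⟨Υ0, Ψ⁽⁰⁾⟩ ≠ 0, and suppose there is a real number ε with 0 < ε < 1/2 such that for every step n the noise satisfies |⟨Υ0, Δ⁽ⁿ⁾⟩| / ‖Ψ⁽ⁿ⁾‖ ≤ (δ/5) · |⟨Υ0, Ψ⁽⁰⁾⟩| / ‖Ψ⁽⁰⁾‖ and ‖Δ⁽ⁿ⁾‖ / ‖Ψ⁽ⁿ⁾‖ ≤ (δ/5) · ε. Then for every n the overlap with the ground state satisfies |⟨Υ0, Ψ⁽ⁿ⁾⟩| / ‖Ψ⁽ⁿ⁾‖ ≥ (7/8) · |⟨Υ0, Ψ⁽⁰⁾⟩| /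 ‖Ψ⁽⁰⁾‖. -/
open scoped ComplexInnerProductSpace

/-- A symmetric operator whose numerical range on an invariant subspace is bounded by `B`
has norm at most `B` on that subspace. -/
theorem LinearMap.IsSymmetric.norm_apply_le_of_abs_re_inner_le_s15
    {V : Type*} [NormedAddCommGroup V] [InnerProductSpace ℂ V] {T : V →ₗ[ℂ] V}
    (hT : T.IsSymmetric) {W : Submodule ℂ V} (hW : ∀ x ∈ W, T x ∈ W) {B : ℝ}
    (hB : ∀ x ∈ W, |(⟪x, T x⟫).re| ≤ B * ‖x‖ ^ 2) {x : V} (hx : x ∈ W) :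
    ‖T x‖ ≤ B * ‖x‖ := by
  rcases eq_or_ne (T x) 0 with h0 | h0
  · rcases eq_or_ne x 0 with hx0 | hx0
    · simp [hx0]
    · have h := (abs_nonneg _).trans (hB x hx)
      have hpos : 0 < ‖x‖ := norm_pos_iff.2 hx0
      rw [h0, norm_zero]
      exact mul_nonneg (nonneg_of_mul_nonneg_left h (by positivity)) hpos.le
  have hx0 : x ≠ 0 := fun h => h0 (by simp [h])
  have hpos : 0 < ‖x‖ := norm_pos_iff.2 hx0
  have hTpos : 0 < ‖T x‖ := norm_pos_iff.2 h0
  set u : V := (‖x‖ : ℂ) • T x with hu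
  set v : V := (‖T x‖ : ℂ) • x with hv
  have huW : u ∈ W := W.smul_mem _ (hW x hx)
  have hvW : v ∈ W := W.smul_mem _ hx
  have hplus := (abs_le.1 (hB _ (W.add_mem huW hvW))).2
  have hminus := (abs_le.1 (hB _ (W.sub_mem huW hvW))).1
  have hnu : ‖u‖ = ‖x‖ * ‖T x‖ := by simp [hu, norm_smul]
  have hnv : ‖v‖ = ‖x‖ * ‖T x‖ := by simp [hv, norm_smul, mul_comm]
  have hsymm : (⟪v, T u⟫).re = (⟪u, T v⟫).re := by
    rw [← hT v u, ← inner_conj_symm, Complex.conj_re]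
  have huv : (⟪u, T v⟫).re = ‖x‖ * ‖T x‖ * ‖T x‖ ^ 2 := by
    simp only [hu, hv, map_smul, inner_smul_left, inner_smul_right, Complex.conj_ofReal,
      Complex.re_ofReal_mul]
    rw [show (⟪T x, T x⟫).re = ‖T x‖ ^ 2 from inner_self_eq_norm_sq (𝕜 := ℂ) _]
    ring
  have hpar := parallelogram_law_with_norm ℂ u v
  simp only [map_add, map_sub, inner_add_left, inner_add_right, inner_sub_left, inner_sub_right,
    Complex.add_re, Complex.sub_re] at hplus hminus
  have hsum : 4 * (‖x‖ * ‖T x‖ * ‖T x‖ ^ 2) ≤ B * (4 * (‖x‖ * ‖T x‖) ^ 2) := by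
    have : B * (‖u + v‖ ^ 2 + ‖u - v‖ ^ 2) = B * (4 * (‖x‖ * ‖T x‖) ^ 2) := by
      rw [hnu, hnv] at hpar
      linear_combination B * hpar
    linarith
  have hfac : 0 < 4 * ‖x‖ * ‖T x‖ ^ 2 := by positivity
  refine le_of_mul_le_mul_left ?_ hfac
  linarith

theorem quartic_bound {s q : ℝ} (hs0 : 0 < s) (hs : s ≤ 7 / 8)
    (hqs : q ≤ 8 / 35 * s) (hq : q ≤ 1 / 10) :
    s ^ 4 + s ^ 2 / 100 ≤ (s - q) ^ 2 := by
  rcases le_total s (7 / 16) with h | h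
  · have h1 : (27 / 35 * s) ^ 2 ≤ (s - q) ^ 2 := by
      apply pow_le_pow_left₀ (by positivity); linarith
    have h2 : s ^ 2 ≤ (7 / 16) ^ 2 := pow_le_pow_left₀ hs0.le h 2
    nlinarith [mul_nonneg (sq_nonneg s) (sub_nonneg.2 h2), sq_nonneg s]
  · have h1 : (s - 1 / 10) ^ 2 ≤ (s - q) ^ 2 := by
      apply pow_le_pow_left₀ (by linarith); linarith
    have h2 := mul_nonneg (sub_nonneg.2 h) (sub_nonneg.2 hs)
    nlinarith [mul_nonneg h2 hs0.le, mul_nonneg h2 (sq_nonneg s)]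

/-- Scalar estimate for one noisy power step: `a` is the current overlap, `A` and `A - d` bound
the operator along and across the ground state, and `d * q` bounds the parallel noise. -/
theorem power_step_bound {A d s a q : ℝ} (hd : 0 < d) (hdA : d ≤ A) (hs0 : 0 < s)
    (hs : s ≤ 7 / 8) (hsa : s ≤ a) (hq0 : 0 ≤ q) (hqs : q ≤ 8 / 35 * s) (hq : q ≤ 1 / 10) :
    0 ≤ A * a - d * q ∧
      s ^ 2 * (A ^ 2 * a ^ 2 + (A - d) ^ 2 * (1 - a ^ 2) + d ^ 2 / 100) ≤
        (A * a - d * q) ^ 2 := by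
  have hA : 0 < A := hd.trans_le hdA
  have ha0 : 0 < a := hs0.trans_le hsa
  have hs2 : s ^ 2 ≤ (7 / 8) ^ 2 := pow_le_pow_left₀ hs0.le hs 2
  have hqlin : q ≤ s * (1 - s ^ 2) := by nlinarith
  have hnonneg : 0 ≤ A * s - d * q := by
    have := mul_le_mul hdA le_rfl hs0.le hA.le
    nlinarith
  have hscale : a * (A * s - d * q) ≤ s * (A * a - d * q) := by
    nlinarith [mul_nonneg (mul_nonneg hd.le hq0) (sub_nonneg.2 hsa)]
  have hstep : 0 ≤ A * a - d * q :=
    nonneg_of_mul_nonneg_right ((mul_nonneg ha0.le hnonneg).trans hscale) hs0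
  refine ⟨hstep, ?_⟩
  have hbase : s ^ 2 * (A ^ 2 * s ^ 2 + (A - d) ^ 2 * (1 - s ^ 2) + d ^ 2 / 100) ≤
      (A * s - d * q) ^ 2 := by
    have h1 := mul_nonneg (mul_nonneg (sub_nonneg.2 hdA) hs0.le)
      (mul_nonneg hd.le (sub_nonneg.2 hqlin))
    have h2 := mul_nonneg (sq_nonneg d) (sub_nonneg.2 (quartic_bound hs0 hs hqs hq))
    linarith
  have hsq : (a * (A * s - d * q)) ^ 2 ≤ (s * (A * a - d * q)) ^ 2 :=
    pow_le_pow_left₀ (mul_nonneg ha0.le hnonneg) hscale 2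
  have hdiff : 0 ≤ (a ^ 2 - s ^ 2) * ((A - d) ^ 2 + d ^ 2 / 100) :=
    mul_nonneg (sub_nonneg.2 (pow_le_pow_left₀ hs0.le hsa 2)) (by positivity)
  refine le_of_mul_le_mul_left ?_ (pow_pos hs0 2)
  linarith [mul_le_mul_of_nonneg_left hbase (sq_nonneg a), mul_nonneg (sq_nonneg s) hdiff]

/-- The shifted Hamiltonian scales the ground-state component by `Λ - E0` and the complement by at
most `Λ - E1`. -/
theorem norm_shift_sub_sq_le
    {V : Type*} [NormedAddCommGroup V] [InnerProductSpace ℂ V]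
    {H : V →ₗ[ℂ] V} (hH : H.IsSymmetric) {u : V} (hu : ‖u‖ = 1) {E0 E1 Emax Λ : ℝ}
    (hgs : H u = (E0 : ℂ) • u)
    (hspec : ∀ ψ : V, ⟪u, ψ⟫ = 0 →
      E1 * ‖ψ‖ ^ 2 ≤ (⟪ψ, H ψ⟫).re ∧ (⟪ψ, H ψ⟫).re ≤ Emax * ‖ψ‖ ^ 2)
    (hΛ : (E1 + Emax) / 2 ≤ Λ) (x : V) :
    ‖(Λ : ℂ) • x - H x‖ ^ 2 ≤
      (Λ - E0) ^ 2 * ‖⟪u, x⟫‖ ^ 2 + (Λ - E1) ^ 2 * (‖x‖ ^ 2 - ‖⟪u, x⟫‖ ^ 2) := by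
  set T : V →ₗ[ℂ] V := (Λ : ℂ) • LinearMap.id - H with hTdef
  have hTapp : ∀ y, T y = (Λ : ℂ) • y - H y := fun y => by simp [hTdef]
  have hTu : T u = ((Λ - E0 : ℝ) : ℂ) • u := by
    rw [hTapp, hgs, ← sub_smul]; push_cast; rfl
  have hT : T.IsSymmetric := fun y z => by
    simp only [hTapp, inner_sub_left, inner_sub_right, inner_smul_left, inner_smul_right,
      Complex.conj_ofReal, hH y z]
  have horthT : ∀ y, ⟪u, y⟫ = 0 → ⟪u, T y⟫ = 0 := fun y hy => by
    rw [← hT u y, hTu, inner_smul_left, hy, mul_zero]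
  have hmem : ∀ y, y ∈ (ℂ ∙ u)ᗮ ↔ ⟪u, y⟫ = 0 := fun y =>
    Submodule.mem_orthogonal_singleton_iff_inner_right
  set w : V := x - ⟪u, x⟫ • u with hw
  have huu : ⟪u, u⟫ = 1 := by rw [inner_self_eq_norm_sq_to_K, hu]; simp
  have huw : ⟪u, w⟫ = 0 := by
    rw [hw, inner_sub_right, inner_smul_right, huu, mul_one, sub_self]
  have hdecomp : x = ⟪u, x⟫ • u + w := by rw [hw]; abel
  have hpyth : ∀ (c : ℂ) (y : V), ⟪u, y⟫ = 0 → ‖c • u + y‖ ^ 2 = ‖c‖ ^ 2 + ‖y‖ ^ 2 := by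
    intro c y hy
    have := norm_add_sq_eq_norm_sq_add_norm_sq_of_inner_eq_zero (𝕜 := ℂ) (c • u) y
      (by rw [inner_smul_left, hy, mul_zero])
    rw [norm_smul, hu, mul_one] at this
    linarith
  have hnx : ‖x‖ ^ 2 = ‖⟪u, x⟫‖ ^ 2 + ‖w‖ ^ 2 := by
    rw [← hpyth _ _ huw, ← hdecomp]
  have hTx : T x = (⟪u, x⟫ * ((Λ - E0 : ℝ) : ℂ)) • u + T w := by
    conv_lhs => rw [hdecomp]
    rw [map_add, map_smul, hTu, smul_smul]
  have hnTw : ‖T w‖ ≤ (Λ - E1) * ‖w‖ := by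
    refine hT.norm_apply_le_of_abs_re_inner_le_s15 (W := (ℂ ∙ u)ᗮ)
      (fun y hy => (hmem _).2 (horthT y ((hmem y).1 hy))) (fun y hy => ?_) ((hmem w).2 huw)
    obtain ⟨h1, h2⟩ := hspec y ((hmem y).1 hy)
    have hre : (⟪y, T y⟫).re = Λ * ‖y‖ ^ 2 - (⟪y, H y⟫).re := by
      rw [hTapp, inner_sub_right, inner_smul_right, inner_self_eq_norm_sq_to_K, Complex.sub_re,
        Complex.re_ofReal_mul]
      norm_cast
    rw [hre, abs_le]
    constructor <;> nlinarith [mul_le_mul_of_nonneg_right hΛ (sq_nonneg ‖y‖)]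
  have hsq : ‖T w‖ ^ 2 ≤ (Λ - E1) ^ 2 * ‖w‖ ^ 2 := by
    rw [← mul_pow]; exact pow_le_pow_left₀ (norm_nonneg _) hnTw 2
  rw [← hTapp, hTx, hpyth _ _ (horthT w huw), norm_mul, Complex.norm_real, mul_pow,
    Real.norm_eq_abs, sq_abs, hnx]
  linarith

/-- **Overlap preservation along the noisy power method.** -/
theorem overlap_preservation
    {V : Type*} [NormedAddCommGroup V] [InnerProductSpace ℂ V] [FiniteDimensional ℂ V]
    (H : V →ₗ[ℂ] V) (hH : H.IsSymmetric)
    (Υ0 : V) (hΥ0 : ‖Υ0‖ = 1)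
    (E0 E1 Emax δ Λ : ℝ)
    (hgs : H Υ0 = (E0 : ℂ) • Υ0)
    (hE01 : E0 ≤ E1) (hE1max : E1 ≤ Emax)
    (hspec : ∀ ψ : V, ⟪Υ0, ψ⟫ = 0 →
      E1 * ‖ψ‖ ^ 2 ≤ (⟪ψ, H ψ⟫).re ∧ (⟪ψ, H ψ⟫).re ≤ Emax * ‖ψ‖ ^ 2)
    (hδ : δ = E1 - E0) (hδpos : 0 < δ)
    (Ψ : ℕ → V) (γ : ℕ → ℂ) (Δ : ℕ → V)
    (hΨne : ∀ n, Ψ n ≠ 0) (hγne : ∀ n, γ n ≠ 0)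
    (hrec : ∀ n, Ψ (n + 1) = γ n • (((Λ : ℂ) • Ψ n - H (Ψ n)) + Δ n))
    (horth : ∀ n, ⟪Δ n, (Λ : ℂ) • Ψ n - H (Ψ n)⟫ = 0)
    (hΛ : (E1 + Emax) / 2 ≤ Λ)
    (hover : ⟪Υ0, Ψ 0⟫ ≠ 0)
    (ε : ℝ) (hε0 : 0 < ε) (hεhalf : ε < 1 / 2)
    (hnoise1 : ∀ n, ‖⟪Υ0, Δ n⟫‖ / ‖Ψ n‖ ≤ δ / 5 * (‖⟪Υ0, Ψ 0⟫‖ / ‖Ψ 0‖))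
    (hnoise2 : ∀ n, ‖Δ n‖ / ‖Ψ n‖ ≤ δ / 5 * ε) :
    ∀ n, 7 / 8 * (‖⟪Υ0, Ψ 0⟫‖ / ‖Ψ 0‖) ≤ ‖⟪Υ0, Ψ n⟫‖ / ‖Ψ n‖ := by
  set t : ℝ := ‖⟪Υ0, Ψ 0⟫‖ / ‖Ψ 0‖ with ht
  have hover_le : ∀ n, ‖⟪Υ0, Ψ n⟫‖ / ‖Ψ n‖ ≤ 1 := fun n => by
    rw [div_le_one (norm_pos_iff.2 (hΨne n))]
    simpa [hΥ0] using norm_inner_le_norm (𝕜 := ℂ) Υ0 (Ψ n)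
  have ht0 : 0 < t := div_pos (norm_pos_iff.2 hover) (norm_pos_iff.2 (hΨne 0))
  have ht1 : t ≤ 1 := hover_le 0
  intro n
  induction n with
  | zero => linarith
  | succ n ih =>
    have hN : 0 < ‖Ψ n‖ := norm_pos_iff.2 (hΨne n)
    set N : ℝ := ‖Ψ n‖
    set a : ℝ := ‖⟪Υ0, Ψ n⟫‖ / N
    set D : V := (Λ : ℂ) • Ψ n - H (Ψ n) with hD
    set P : ℝ := ‖⟪Υ0, Δ n⟫‖
    have haN : ‖⟪Υ0, Ψ n⟫‖ = a * N := (div_mul_cancel₀ _ hN.ne').symm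
    set q : ℝ := P / N / δ with hq
    have hPN : P = δ * q * N := by rw [hq]; field_simp
    have hΔ : ‖Δ n‖ ≤ δ / 10 * N := by
      rw [← div_le_iff₀ hN]
      exact (hnoise2 n).trans (by nlinarith)
    have hPΔ : P ≤ ‖Δ n‖ := by simpa [hΥ0] using norm_inner_le_norm (𝕜 := ℂ) Υ0 (Δ n)
    have hqt : q ≤ 8 / 35 * (7 / 8 * t) := by
      rw [hq, div_le_iff₀ hδpos]
      linarith [hnoise1 n]
    have hq10 : q ≤ 1 / 10 := by
      rw [hq, div_le_iff₀ hδpos, div_le_iff₀ hN]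
      linarith
    obtain ⟨hstep0, hstep⟩ := power_step_bound (A := Λ - E0) hδpos (by linarith)
      (by linarith : 0 < 7 / 8 * t) (by linarith) ih (by positivity : 0 ≤ q) hqt hq10
    have hnext : Ψ (n + 1) = γ n • (D + Δ n) := hrec n
    have hne : D + Δ n ≠ 0 := fun h => hΨne (n + 1) (by rw [hnext, h, smul_zero])
    have hinner : ⟪Υ0, D⟫ = ((Λ - E0 : ℝ) : ℂ) * ⟪Υ0, Ψ n⟫ := by
      rw [hD, inner_sub_right, inner_smul_right, ← hH, hgs, inner_smul_left, Complex.conj_ofReal]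
      push_cast; ring
    have hlower : ((Λ - E0) * a - δ * q) * N ≤ ‖⟪Υ0, D + Δ n⟫‖ := by
      have h := norm_sub_le_norm_add (⟪Υ0, D⟫) (⟪Υ0, Δ n⟫)
      rw [hinner, norm_mul, Complex.norm_real, Real.norm_of_nonneg (by linarith), haN] at h
      rw [inner_add_right, hinner]
      linarith
    have hupper : ‖D + Δ n‖ ^ 2 ≤
        ((Λ - E0) ^ 2 * a ^ 2 + (Λ - E0 - δ) ^ 2 * (1 - a ^ 2) + δ ^ 2 / 100) * N ^ 2 := by
      have h1 := norm_shift_sub_sq_le hH hΥ0 hgs hspec hΛ (Ψ n)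
      have h2 := norm_add_sq_eq_norm_sq_add_norm_sq_of_inner_eq_zero (𝕜 := ℂ) (Δ n) D (horth n)
      have h3 := pow_le_pow_left₀ (norm_nonneg _) hΔ 2
      rw [haN] at h1
      rw [add_comm D, show Λ - E0 - δ = Λ - E1 by linarith]
      linarith
    rw [hnext, inner_smul_right, norm_mul, norm_smul,
      mul_div_mul_left _ _ (norm_ne_zero_iff.2 (hγne n)), le_div_iff₀ (norm_pos_iff.2 hne)]
    refine le_trans ?_ hlower
    refine (abs_le_of_sq_le_sq' ?_ (mul_nonneg hstep0 hN.le)).2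
    rw [mul_pow, mul_pow _ N]
    calc (7 / 8 * t) ^ 2 * ‖D + Δ n‖ ^ 2 ≤ _ := mul_le_mul_of_nonneg_left hupper (sq_nonneg _)
      _ ≤ _ := by rw [← mul_assoc]; exact mul_le_mul_of_nonneg_right hstep (sq_nonneg _)
end
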